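/- Let n ≥ 2 and 1 ≤ r, s < ∞ with 1/r + 1/s > 1. If (1/r, 1/s) does not belong to the closed trapezium F_n, then the sparse bound ‖M_full : (r,s)_m‖ < ∞ fails; that is, for every constant C there exist bounded compactly supported measurable f, g ≥ 0 such that ∫ (M_full f)·g dx > C · sup Λ_{𝒮,r,s,m}(f,g), the supremum over all sparse collections 𝒮 and all admissible families {F_S}. -/

import Mathlib

open MeasureTheory Metric Set
open scoped ENNReal NNReal

noncomputable section

abbrev Rn (n : ℕ) := EuclideanSpace ℝ (Fin n)

/-- The normalized rotation-invariant measure on the unit sphere of `ℝⁿ`. -/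
def sphMeasure (n : ℕ) : Measure (Rn n) :=
  ((μH[(n : ℝ) - 1]) (sphere (0 : Rn n) 1))⁻¹ • (μH[(n : ℝ) - 1]).restrict (sphere (0 : Rn n) 1)

/-- The spherical average `A_t f (x)`. -/
def sphereAvg (n : ℕ) (t : ℝ) (f : Rn n → ℝ) (x : Rn n) : ℝ :=
  ∫ y, f (x - t • y) ∂(sphMeasure n)

/-- The lacunary spherical maximal function. -/
def Mlac (n : ℕ) (f : Rn n → ℝ) (x : Rn n) : ℝ :=
  ⨆ j : ℤ, sphereAvg n ((2 : ℝ) ^ j) (fun z => |f z|) x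

/-- The full spherical maximal function. -/
def Mfull (n : ℕ) (f : Rn n → ℝ) (x : Rn n) : ℝ :=
  ⨆ t : {t : ℝ // 0 < t}, sphereAvg n (t : ℝ) (fun z => |f z|) x

/-- An axis-parallel cube in `ℝⁿ`. -/
structure Cube (n : ℕ) where
  corner : Fin n → ℝ
  side : ℝ
  side_pos : 0 < side

/-- The set of points of a cube. -/
def Cube.toSet {n : ℕ} (Q : Cube n) : Set (Rn n) :=
  {x | ∀ i, Q.corner i ≤ x i ∧ x i ≤ Q.corner i + Q.side}

/-- `⟨f⟩_{Q,r}`, the normalized `L^r` average of `f` over the cube `Q`. -/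
def cubeAvg {n : ℕ} (Q : Cube n) (r : ℝ) (f : Rn n → ℝ) : ℝ :=
  ((volume Q.toSet).toReal⁻¹ * ∫ x in Q.toSet, |f x| ^ r) ^ (1 / r)

/-- The plain average of `w` over a cube `Q`. -/
def avgCube {n : ℕ} (Q : Cube n) (w : Rn n → ℝ) : ℝ :=
  (volume Q.toSet).toReal⁻¹ * ∫ x in Q.toSet, w x

/-- A sparse collection of cubes. -/
def IsSparse {n : ℕ} (𝒮 : Set (Cube n)) : Prop :=
  ∃ E : Cube n → Set (Rn n),
    (∀ S ∈ 𝒮, MeasurableSet (E S)) ∧ (∀ S ∈ 𝒮, E S ⊆ S.toSet) ∧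
    (∀ S ∈ 𝒮, volume S.toSet < 4 * volume (E S)) ∧
    𝒮.PairwiseDisjoint E

/-- An admissible family `{F_S}` for the `m`-sparse form: pairwise disjoint, `F_S ⊆ S`. -/
def IsAdmissible {n : ℕ} (𝒮 : Set (Cube n)) (F : Cube n → Set (Rn n)) : Prop :=
  (∀ S ∈ 𝒮, MeasurableSet (F S)) ∧ (∀ S ∈ 𝒮, F S ⊆ S.toSet) ∧ 𝒮.PairwiseDisjoint F

/-- The `(r,s)_m`-sparse form `Λ_{𝒮,r,s,m}(f,g)`. -/
def sparseFormM {n : ℕ} (𝒮 : Set (Cube n)) (F : Cube n → Set (Rn n)) (r s : ℝ)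
    (f g : Rn n → ℝ) : ℝ≥0∞ :=
  ∑' S : 𝒮, volume (S : Cube n).toSet * ENNReal.ofReal (cubeAvg (S : Cube n) r f) *
    ENNReal.ofReal (cubeAvg (S : Cube n) s ((F (S : Cube n)).indicator g))

/-- The supremum of `(r,s)_m` sparse forms over all sparse collections and admissible families. -/
def supSparseFormM (n : ℕ) (r s : ℝ) (f g : Rn n → ℝ) : ℝ≥0∞ :=
  ⨆ (𝒮 : Set (Cube n)) (F : Cube n → Set (Rn n)) (_ : IsSparse 𝒮) (_ : IsAdmissible 𝒮 F),
    sparseFormM 𝒮 F r s f g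

/-- The sparse bound `‖T : (r,s)_m‖ < ∞`. -/
def SparseBoundM (n : ℕ) (r s : ℝ) (T : (Rn n → ℝ) → Rn n → ℝ) : Prop :=
  ∃ C : ℝ, 0 ≤ C ∧ ∀ f g : Rn n → ℝ, Measurable f → Measurable g →
    (∀ x, 0 ≤ f x) → (∀ x, 0 ≤ g x) →
    (∃ M, ∀ x, f x ≤ M) → (∃ M, ∀ x, g x ≤ M) →
    HasCompactSupport f → HasCompactSupport g →
    ENNReal.ofReal (∫ x, T f x * g x) ≤ ENNReal.ofReal C * supSparseFormM n r s f g

/-- The closed triangle `L_n` with vertices `(0,1)`, `(1,0)`, `(n/(n+1), n/(n+1))`. -/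
def Lregion (n : ℕ) : Set (ℝ × ℝ) :=
  convexHull ℝ {((0 : ℝ), (1 : ℝ)), (1, 0), ((n : ℝ)/(n+1), (n : ℝ)/(n+1))}

/-- The closed triangle `L'_n` with vertices `(0,0)`, `(1,1)`, `(n/(n+1), 1/(n+1))`. -/
def Lregion' (n : ℕ) : Set (ℝ × ℝ) :=
  convexHull ℝ {((0 : ℝ), (0 : ℝ)), (1, 1), ((n : ℝ)/(n+1), 1/((n : ℝ)+1))}

/-- The closed trapezium `F_n`. -/
def Fregion (n : ℕ) : Set (ℝ × ℝ) :=
  convexHull ℝ {((0 : ℝ), (1 : ℝ)), (((n : ℝ)-1)/n, 1/(n : ℝ)),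
    (((n : ℝ)-1)/n, ((n : ℝ)-1)/n),
    (((n : ℝ)^2 - n)/((n : ℝ)^2 + 1), ((n : ℝ)^2 - n + 2)/((n : ℝ)^2 + 1))}

/-- The closed trapezium `F'_n`. -/
def Fregion' (n : ℕ) : Set (ℝ × ℝ) :=
  convexHull ℝ {((0 : ℝ), (0 : ℝ)), (((n : ℝ)-1)/n, ((n : ℝ)-1)/n),
    (((n : ℝ)-1)/n, 1/(n : ℝ)),
    (((n : ℝ)^2 - n)/((n : ℝ)^2 + 1), ((n : ℝ)-1)/((n : ℝ)^2 + 1))}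

/-- A dyadic cube `2^q([0,1)^n + m)`. -/
def IsDyadic {n : ℕ} (Q : Cube n) : Prop :=
  ∃ (q : ℤ) (m : Fin n → ℤ), Q.side = (2 : ℝ) ^ q ∧ ∀ i, Q.corner i = (2 : ℝ) ^ q * m i

/-- The concentric cube `(1/3)Q` of one third the side length. -/
def Cube.third {n : ℕ} (Q : Cube n) : Cube n :=
  ⟨fun i => Q.corner i + Q.side / 3, Q.side / 3, by have := Q.side_pos; linarith⟩

/-- `A_Q f = A_{ℓQ/4}(f · 1_{(1/3)Q})`. -/
def AQ {n : ℕ} (Q : Cube n) (f : Rn n → ℝ) (x : Rn n) : ℝ :=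
  sphereAvg n (Q.side / 4) (Q.third.toSet.indicator f) x

/-- `M̃_Q f = sup_{ℓQ/8 ≤ t < ℓQ/4} A_t (f · 1_{(1/3)Q})`. -/
def MtildeQ {n : ℕ} (Q : Cube n) (f : Rn n → ℝ) (x : Rn n) : ℝ :=
  ⨆ t : {t : ℝ // Q.side / 8 ≤ t ∧ t < Q.side / 4},
    sphereAvg n (t : ℝ) (Q.third.toSet.indicator f) x

/-- A weight: a positive locally integrable function. -/
def IsWeight {n : ℕ} (w : Rn n → ℝ) : Prop :=
  (∀ x, 0 < w x) ∧ LocallyIntegrable w volume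

/-- The Muckenhoupt class `A₁`. -/
def MemA1 {n : ℕ} (w : Rn n → ℝ) : Prop :=
  IsWeight w ∧ ∃ C : ℝ, ∀ Q : Cube n, ∀ᵐ x ∂volume, x ∈ Q.toSet → avgCube Q w ≤ C * w x

/-- The Muckenhoupt class `A_p`, `1 < p < ∞`. -/
def MemAp {n : ℕ} (p : ℝ) (w : Rn n → ℝ) : Prop :=
  IsWeight w ∧ ∃ C : ℝ, ∀ Q : Cube n,
    avgCube Q w * (avgCube Q fun x => w x ^ (1 - p/(p-1))) ^ (p - 1) ≤ C

/-- The reverse Hölder class `RH_ρ`. -/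
def MemRH {n : ℕ} (ρ : ℝ) (w : Rn n → ℝ) : Prop :=
  IsWeight w ∧ ∃ C : ℝ, ∀ Q : Cube n, cubeAvg Q ρ w ≤ C * avgCube Q w

/-- The measure `w dx` associated to a weight. -/
def wMeasure {n : ℕ} (w : Rn n → ℝ) : Measure (Rn n) :=
  volume.withDensity fun x => ENNReal.ofReal (w x)

/-- The dual exponent `x' = x/(x-1)`. -/
def dualExp (x : ℝ) : ℝ := x / (x - 1)

/-- `φ_lac(r)`, defined through `1/φ_lac(1/r)` as in Corollary 5.4(1). -/
def phiLac (n : ℕ) (r : ℝ) : ℝ :=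
  if 1/r ≤ (n : ℝ)/(n+1) then (1 - 1/(r*n))⁻¹ else ((n : ℝ)*(1 - 1/r))⁻¹

/-- `φ_full(r)`, the piecewise linear function of Statement 16. -/
def phiFull (n : ℕ) (r : ℝ) : ℝ :=
  if 1/r ≤ ((n : ℝ)^2 - n)/((n : ℝ)^2 + 1) then (1 - 1/(r*n))⁻¹
  else (((n : ℝ)-1)/n + (((n : ℝ)+1)/((n : ℝ)-1)) * ((((n : ℝ)-1))/n - 1/r))⁻¹

end

open MeasureTheory Metric Set
open scoped ENNReal NNReal


section sphereMeasure

lemma norm_le_sum_abs {n : ℕ} (x : Rn n) : ‖x‖ ≤ ∑ i, |x i| := by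
  have h0 : 0 ≤ ∑ i, |x i| := Finset.sum_nonneg fun i _ => abs_nonneg _
  refine le_of_sq_le_sq ?_ h0
  rw [EuclideanSpace.norm_sq_eq]
  have : ∀ i, ‖x i‖ ^ 2 ≤ |x i| * ∑ j, |x j| := by
    intro i
    rw [Real.norm_eq_abs, sq]
    exact mul_le_mul_of_nonneg_left
      (Finset.single_le_sum (f := fun j => |x j|) (fun j _ => abs_nonneg _) (Finset.mem_univ i))
      (abs_nonneg _)
  calc _ ≤ ∑ i, |x i| * ∑ j, |x j| := Finset.sum_le_sum fun i _ => this i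
    _ = _ := by rw [← Finset.sum_mul, sq]

lemma abs_apply_le {n : ℕ} (x : Rn n) (i : Fin n) : |x i| ≤ ‖x‖ := by
  simpa using PiLp.norm_apply_le x i

lemma norm_sq_succ {m : ℕ} (x : Rn (m+1)) : ‖x‖ ^ 2 = x 0 ^ 2 + ∑ i : Fin m, x i.succ ^ 2 := by
  rw [EuclideanSpace.norm_sq_eq, Fin.sum_univ_succ]; simp

lemma normalize_lip {E : Type*} [NormedAddCommGroup E] [NormedSpace ℝ E] (v w : E)
    (hv : 1 ≤ ‖v‖) (hw : 1 ≤ ‖w‖) : ‖‖v‖⁻¹ • v - ‖w‖⁻¹ • w‖ ≤ 2 * ‖v - w‖ := by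
  have e : ‖v‖⁻¹ • v - ‖w‖⁻¹ • w = ‖v‖⁻¹ • (v - w) + (‖v‖⁻¹ - ‖w‖⁻¹) • w := by
    rw [smul_sub, sub_smul]; abel
  have hv0 : 0 < ‖v‖ := by linarith
  have hw0 : 0 < ‖w‖ := by linarith
  rw [e]
  have h1 : ‖‖v‖⁻¹ • (v - w)‖ ≤ ‖v - w‖ := by
    rw [norm_smul, norm_inv, norm_norm]
    exact mul_le_of_le_one_left (norm_nonneg _) (inv_le_one_of_one_le₀ hv)
  have h2 : ‖(‖v‖⁻¹ - ‖w‖⁻¹) • w‖ ≤ ‖v - w‖ := by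
    rw [norm_smul, Real.norm_eq_abs]
    have : |‖v‖⁻¹ - ‖w‖⁻¹| * ‖w‖ = ‖v‖⁻¹ * |‖w‖ - ‖v‖| := by
      have : ‖v‖⁻¹ - ‖w‖⁻¹ = ‖v‖⁻¹ * ‖w‖⁻¹ * (‖w‖ - ‖v‖) := by field_simp
      rw [this, abs_mul, abs_of_pos (by positivity)]
      field_simp
    rw [this]
    have h3 : |‖w‖ - ‖v‖| ≤ ‖v - w‖ := by
      rw [abs_sub_comm]; exact abs_norm_sub_norm_le v w
    calc _ ≤ 1 * |‖w‖ - ‖v‖| := by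
          gcongr; exact inv_le_one_of_one_le₀ hv
      _ ≤ _ := by linarith
  linarith [norm_add_le (‖v‖⁻¹ • (v - w)) ((‖v‖⁻¹ - ‖w‖⁻¹) • w)]

def faceVec {m : ℕ} (i : Fin (m+1)) (e : ℝ) (y : Fin m → ℝ) : Rn (m+1) :=
  WithLp.toLp 2 (i.insertNth (α := fun _ => ℝ) e y)

lemma faceVec_norm {m : ℕ} (i : Fin (m+1)) (e : ℝ) (he : |e| = 1) (y : Fin m → ℝ) :
    1 ≤ ‖faceVec i e y‖ := by
  have := abs_apply_le (faceVec i e y) i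
  simpa [faceVec, he] using this

lemma faceVec_sub {m : ℕ} (i : Fin (m+1)) (e : ℝ) (y z : Fin m → ℝ) :
    ‖faceVec i e y - faceVec i e z‖ ≤ m * ‖y - z‖ := by
  refine (norm_le_sum_abs _).trans ?_
  rw [Fin.sum_univ_succAbove _ i]
  simp only [faceVec, PiLp.sub_apply, Fin.insertNth_apply_same, Fin.insertNth_apply_succAbove]
  simp only [sub_self, abs_zero, zero_add]
  calc _ ≤ ∑ j : Fin m, ‖y - z‖ := Finset.sum_le_sum fun j _ => by
        simpa using norm_le_pi_norm (y - z) j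
    _ = _ := by simp

lemma face_lip {m : ℕ} (i : Fin (m+1)) (e : ℝ) (he : |e| = 1) :
    LipschitzWith (2 * m) (fun y : Fin m → ℝ => ‖faceVec i e y‖⁻¹ • faceVec i e y) := by
  refine LipschitzWith.of_dist_le_mul fun y z => ?_
  rw [dist_eq_norm, dist_eq_norm]
  refine (normalize_lip _ _ (faceVec_norm i e he y) (faceVec_norm i e he z)).trans ?_
  have := faceVec_sub i e y z
  push_cast
  linarith

lemma sphere_cover {m : ℕ} : sphere (0 : Rn (m+1)) 1 ⊆
    ⋃ i : Fin (m+1), ⋃ e ∈ ({1, -1} : Set ℝ),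
      (fun y : Fin m → ℝ => ‖faceVec i e y‖⁻¹ • faceVec i e y) '' closedBall 0 1 := by
  intro x hx
  have hx1 : ‖x‖ = 1 := by simpa using hx
  obtain ⟨i, -, hi⟩ := Finset.exists_max_image Finset.univ (fun i => |x i|) Finset.univ_nonempty
  have hpos : 0 < |x i| := by
    rcases (abs_nonneg (x i)).lt_or_eq with h | h
    · exact h
    · exfalso
      have : ‖x‖ ≤ ∑ i, |x i| := norm_le_sum_abs x
      have h0 : ∑ j, |x j| ≤ 0 := Finset.sum_nonpos fun j hj => by rw [h]; exact hi j hj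
      linarith
  have hv : faceVec i (x i / |x i|) (fun j => x (i.succAbove j) / |x i|) = |x i|⁻¹ • x := by
    ext j
    refine i.succAboveCases ?_ (fun j => ?_) j
    · simp [faceVec, div_eq_inv_mul]
    · simp [faceVec, div_eq_inv_mul]
  simp only [mem_iUnion]
  refine ⟨i, x i / |x i|, ?_, fun j => x (i.succAbove j) / |x i|, ?_, ?_⟩
  · rcases lt_or_gt_of_ne (abs_pos.1 hpos) with h | h
    · right; rw [abs_of_neg h, div_neg, div_self h.ne]; rfl
    · left; rw [abs_of_pos h, div_self h.ne']
  · rw [mem_closedBall, dist_zero_right, pi_norm_le_iff_of_nonneg zero_le_one]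
    intro j
    rw [Real.norm_eq_abs, abs_div, abs_abs, div_le_one hpos]
    exact hi _ (Finset.mem_univ _)
  · simp only [hv, norm_smul, norm_inv, hx1, Real.norm_eq_abs, abs_abs]
    rw [smul_smul]
    field_simp
    simp

lemma hausdorff_sphere_lt_top (m : ℕ) : (μH[(m:ℝ)]) (sphere (0 : Rn (m+1)) 1) < ⊤ := by
  refine (measure_mono sphere_cover).trans_lt ?_
  refine (measure_iUnion_le _).trans_lt ?_
  rw [tsum_fintype]
  refine ENNReal.sum_lt_top.2 fun i _ => ?_
  have hfin : ({1, -1} : Set ℝ).Finite := by simp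
  refine measure_biUnion_lt_top hfin fun e he => ?_
  have he1 : |e| = 1 := by
    rcases he with rfl | he
    · simp
    · rw [mem_singleton_iff.1 he]; simp
  refine ((face_lip i e he1).hausdorffMeasure_image_le (Nat.cast_nonneg m) _).trans_lt ?_
  have hv : (μH[(m:ℝ)] : Measure (Fin m → ℝ)) = volume := by
    have := @hausdorffMeasure_pi_real (Fin m) _
    simpa using this
  rw [hv]
  refine ENNReal.mul_lt_top ?_ ?_
  · exact ENNReal.rpow_lt_top_of_nonneg (Nat.cast_nonneg m) ENNReal.coe_ne_top
  · exact (isCompact_closedBall _ _).measure_lt_top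

def capSet {m : ℕ} (a : Fin m → ℝ) (ρ : ℝ) : Set (Rn (m+1)) :=
  {y | 0 ≤ y 0 ∧ ∀ i : Fin m, |y i.succ - a i| ≤ ρ}

lemma capSet_closed {m : ℕ} (a : Fin m → ℝ) (ρ : ℝ) : IsClosed (capSet a ρ) := by
  have : capSet a ρ = {y | 0 ≤ y 0} ∩ ⋂ i : Fin m, {y | |y i.succ - a i| ≤ ρ} := by
    ext y; simp [capSet]
  rw [this]
  refine IsClosed.inter (isClosed_le (by fun_prop) (by fun_prop)) ?_
  exact isClosed_iInter fun i => isClosed_le (by fun_prop) (by fun_prop)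

lemma cap_lower {m : ℕ} (a : Fin m → ℝ) (ρ : ℝ) (hρ : 0 < ρ)
    (h : ∀ b : Fin m → ℝ, (∀ i, |b i - a i| ≤ ρ) → ∑ i, b i ^ 2 ≤ 1) :
    ENNReal.ofReal ((2 * ρ) ^ m) ≤ (μH[(m:ℝ)]) (capSet a ρ ∩ sphere (0 : Rn (m+1)) 1) := by
  have hv : (μH[(m:ℝ)] : Measure (Fin m → ℝ)) = volume := by
    have := @hausdorffMeasure_pi_real (Fin m) _
    simpa using this
  have hlip : LipschitzWith 1 (fun (y : Rn (m+1)) (i : Fin m) => y i.succ) := by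
    refine LipschitzWith.of_dist_le_mul fun y z => ?_
    rw [NNReal.coe_one, one_mul, dist_pi_le_iff dist_nonneg]
    intro i
    rw [Real.dist_eq, dist_eq_norm]
    exact abs_apply_le (y - z) i.succ
  have hsub : closedBall a ρ ⊆
      (fun (y : Rn (m+1)) (i : Fin m) => y i.succ) '' (capSet a ρ ∩ sphere (0 : Rn (m+1)) 1) := by
    intro b hb
    have hb' : ∀ i, |b i - a i| ≤ ρ := by
      intro i
      rw [mem_closedBall, dist_pi_le_iff hρ.le] at hb
      simpa [Real.dist_eq] using hb i
    have hs := h b hb'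
    refine ⟨WithLp.toLp 2 (Fin.cons (√(1 - ∑ i, b i ^ 2)) b : Fin (m+1) → ℝ), ⟨⟨?_, ?_⟩, ?_⟩, ?_⟩
    · simp
    · intro i; simpa using hb' i
    · rw [mem_sphere_zero_iff_norm]
      have : ‖(WithLp.toLp 2 (Fin.cons (√(1 - ∑ i, b i ^ 2)) b : Fin (m+1) → ℝ) : Rn (m+1))‖ ^ 2 = 1 := by
        rw [norm_sq_succ]
        simp only [Fin.cons_zero, Fin.cons_succ]
        rw [Real.sq_sqrt (by linarith)]; ring
      exact (pow_eq_one_iff_of_nonneg (norm_nonneg _) two_ne_zero).1 this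
    · ext i; simp
  have h1 := hlip.hausdorffMeasure_image_le (Nat.cast_nonneg m) (capSet a ρ ∩ sphere (0 : Rn (m+1)) 1)
  simp only [ENNReal.coe_one, ENNReal.one_rpow, one_mul] at h1
  refine le_trans ?_ h1
  rw [hv]
  refine le_trans ?_ (measure_mono hsub)
  rw [Real.volume_pi_closedBall _ hρ.le]
  simp

lemma hausdorff_sphere_pos (m : ℕ) (hm : 1 ≤ m) : 0 < (μH[(m:ℝ)]) (sphere (0 : Rn (m+1)) 1) := by
  have hm' : (1:ℝ) ≤ m := by exact_mod_cast hm
  have := cap_lower (m := m) 0 (1/m) (by positivity) (by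
    intro b hb
    have : ∀ i, b i ^ 2 ≤ 1/m := by
      intro i
      have h1 : |b i| ≤ 1/m := by simpa using hb i
      rw [← sq_abs]
      have h2 : (1:ℝ)/m ≤ 1 := by rw [div_le_one (by linarith)]; exact hm'
      nlinarith [abs_nonneg (b i)]
    calc _ ≤ ∑ i : Fin m, (1:ℝ)/m := Finset.sum_le_sum fun i _ => this i
      _ = 1 := by simp; field_simp)
  refine lt_of_lt_of_le ?_ (this.trans (measure_mono inter_subset_right))
  rw [ENNReal.ofReal_pos]; positivity

lemma sphMeasure_eq (m : ℕ) : sphMeasure (m+1) =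
    ((μH[(m : ℝ)]) (sphere (0 : Rn (m+1)) 1))⁻¹ • (μH[(m : ℝ)]).restrict (sphere (0 : Rn (m+1)) 1) := by
  have : (((m+1 : ℕ) : ℝ) - 1) = m := by push_cast; ring
  rw [sphMeasure, this]

lemma sphMeasure_prob (m : ℕ) (hm : 1 ≤ m) : IsProbabilityMeasure (sphMeasure (m+1)) := by
  constructor
  rw [sphMeasure_eq]
  simp only [Measure.smul_apply, Measure.restrict_apply MeasurableSet.univ, univ_inter, smul_eq_mul]
  exact ENNReal.inv_mul_cancel (hausdorff_sphere_pos m hm).ne' (hausdorff_sphere_lt_top m).ne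

lemma sphMeasure_compl (m : ℕ) : sphMeasure (m+1) (sphere (0 : Rn (m+1)) 1)ᶜ = 0 := by
  rw [sphMeasure_eq, Measure.smul_apply, Measure.restrict_apply isClosed_sphere.measurableSet.compl]
  simp

/-- Lower bound for the normalized measure of caps. -/
lemma sphMeasure_cap (m : ℕ) (hm : 1 ≤ m) : ∃ c : ℝ, 0 < c ∧ ∀ (a : Fin m → ℝ) (ρ : ℝ), 0 < ρ →
    (∀ b : Fin m → ℝ, (∀ i, |b i - a i| ≤ ρ) → ∑ i, b i ^ 2 ≤ 1) →
    ∀ V : Set (Rn (m+1)), (capSet a ρ ∩ sphere (0 : Rn (m+1)) 1 ⊆ V) →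
    ENNReal.ofReal (c * ρ ^ m) ≤ sphMeasure (m+1) V := by
  set H := (μH[(m : ℝ)]) (sphere (0 : Rn (m+1)) 1) with hH
  have hpos := hausdorff_sphere_pos m hm
  have hfin := hausdorff_sphere_lt_top m
  refine ⟨H.toReal⁻¹ * 2 ^ m, ?_, ?_⟩
  · have : 0 < H.toReal := ENNReal.toReal_pos hpos.ne' hfin.ne
    positivity
  · intro a ρ hρ h V hV
    refine le_trans ?_ (measure_mono hV)
    rw [sphMeasure_eq, Measure.smul_apply, Measure.restrict_apply
      ((capSet_closed a ρ).inter isClosed_sphere).measurableSet, inter_assoc, inter_self, smul_eq_mul]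
    have := cap_lower a ρ hρ h
    rw [mul_assoc, ← mul_pow, ENNReal.ofReal_mul (by positivity), ← ENNReal.toReal_inv,
      ENNReal.ofReal_toReal (by simpa using hpos.ne')]
    gcongr

end sphereMeasure

section sparseUpper

lemma cube_volume {n : ℕ} (Q : Cube n) : volume Q.toSet = ENNReal.ofReal (Q.side ^ n) := by
  have h : Q.toSet = (MeasurableEquiv.toLp 2 (Fin n → ℝ)).symm ⁻¹'
      (Icc Q.corner (fun i => Q.corner i + Q.side)) := by
    ext x
    simp [Cube.toSet, Pi.le_def, forall_and]
  rw [h, (EuclideanSpace.volume_preserving_symm_measurableEquiv_toLp (Fin n)).measure_preimage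
    measurableSet_Icc.nullMeasurableSet, Real.volume_Icc_pi]
  simp [ENNReal.ofReal_pow Q.side_pos.le]

lemma cube_norm_sub {n : ℕ} (Q : Cube n) {x y : Rn n} (hx : x ∈ Q.toSet) (hy : y ∈ Q.toSet) :
    ‖x - y‖ ≤ n * Q.side := by
  refine (norm_le_sum_abs _).trans ?_
  calc _ ≤ ∑ i : Fin n, Q.side := Finset.sum_le_sum fun i _ => by
        have h1 := hx i
        have h2 := hy i
        rw [PiLp.sub_apply, abs_le]; constructor <;> linarith [h1.1, h1.2, h2.1, h2.2]
    _ = _ := by simp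

/-- Averages of indicator functions. -/
lemma cubeAvg_le {n : ℕ} (Q : Cube n) (r : ℝ) (hr : 1 ≤ r) (A : Set (Rn n)) (hA : MeasurableSet A)
    (D : Set (Rn n)) (hDA : D ⊆ A) (hD : MeasurableSet D) (v : ℝ) (hv : 0 ≤ v) (hAv : volume A ≤ ENNReal.ofReal v) :
    cubeAvg Q r (D.indicator fun _ => 1) ≤ ((Q.side ^ n)⁻¹ * v) ^ (1/r) := by
  have h0 := Q.side_pos
  have e : (fun x => |D.indicator (fun _ => (1:ℝ)) x| ^ r) = D.indicator (fun _ => (1:ℝ)) := by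
    ext x
    by_cases hx : x ∈ D <;> simp [hx, Real.zero_rpow (by linarith : r ≠ 0)]
  have hvol : volume (Q.toSet ∩ D) ≤ ENNReal.ofReal v :=
    (measure_mono (inter_subset_right.trans hDA)).trans hAv
  rw [cubeAvg, e, setIntegral_indicator hD, cube_volume, ENNReal.toReal_ofReal (by positivity)]
  simp only [integral_const, smul_eq_mul, mul_one, MeasurableSet.univ, measureReal_restrict_apply, univ_inter]
  refine Real.rpow_le_rpow (by positivity) ?_ (by positivity)
  gcongr
  exact ENNReal.toReal_le_of_le_ofReal hv hvol

lemma cubeAvg_zero {n : ℕ} (Q : Cube n) (r : ℝ) (hr : 1 ≤ r) (D : Set (Rn n)) 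
    (hD : ∀ x ∈ Q.toSet, x ∉ D) :
    cubeAvg Q r (D.indicator fun _ => 1) = 0 := by
  rw [cubeAvg]
  have : ∫ x in Q.toSet, |D.indicator (fun _ => (1:ℝ)) x| ^ r = 0 := by
    refine setIntegral_eq_zero_of_forall_eq_zero fun x hx => ?_
    simp [hD x hx, Real.zero_rpow (by linarith : r ≠ 0)]
  rw [this, mul_zero, Real.zero_rpow]
  have : 0 < 1/r := by positivity
  exact this.ne'

lemma sparse_upper (n : ℕ) (hn : 1 ≤ n) (r s : ℝ) (hr : 1 ≤ r) (hs : 1 ≤ s) (hrs : 1 < 1/r + 1/s) :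
    ∃ K : ℝ, 0 < K ∧ ∀ (A B : Set (Rn n)) (a b : ℝ), MeasurableSet A → MeasurableSet B →
      0 ≤ a → 0 ≤ b → volume A ≤ ENNReal.ofReal a → volume B ≤ ENNReal.ofReal b →
      (∀ x ∈ B, ‖x‖ ≤ 3) → (∀ z ∈ A, ∀ x ∈ B, 1/2 ≤ ‖z - x‖) →
      supSparseFormM n r s (A.indicator fun _ => 1) (B.indicator fun _ => 1) ≤
        ENNReal.ofReal (K * a ^ (1/r) * b ^ (1/s)) := by
  have hn' : (1:ℝ) ≤ n := by exact_mod_cast hn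
  set p : ℝ := 1/r + 1/s with hp
  set w : Rn n → ℝ≥0∞ := fun z => ENNReal.ofReal ((1 + ‖z‖) ^ (-(n * p))) with hw
  have hI : ∫⁻ z, w z < ⊤ := by
    refine finite_integral_one_add_norm ?_
    simp only [finrank_euclideanSpace, Fintype.card_fin]
    nlinarith
  set I : ℝ := (∫⁻ z, w z).toReal with hIdef
  have hIr : ∫⁻ z, w z = ENNReal.ofReal I := (ENNReal.ofReal_toReal hI.ne).symm
  have hI0 : 0 ≤ I := ENNReal.toReal_nonneg
  set L : ℝ := 9 * n with hL
  have hL0 : 0 < L := by positivity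
  set K0 : ℝ := 4 * L ^ (n * p) with hK0
  have hK00 : 0 < K0 := by positivity
  refine ⟨K0 * (I + 1), by positivity, ?_⟩
  intro A B a b hA hB ha hb hAa hBb hB3 hAB
  refine iSup_le fun 𝒮 => iSup_le fun F => iSup_le fun hS => iSup_le fun hF => ?_
  obtain ⟨E, hEm, hES, hEv, hEd⟩ := hS
  obtain ⟨hFm, hFS, hFd⟩ := hF
  have key : ∀ S : 𝒮, volume (S : Cube n).toSet *
      ENNReal.ofReal (cubeAvg (S : Cube n) r (A.indicator fun _ => 1)) *
      ENNReal.ofReal (cubeAvg (S : Cube n) s ((F (S : Cube n)).indicator (B.indicator fun _ => 1)))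
      ≤ ENNReal.ofReal (K0 * a ^ (1/r) * b ^ (1/s)) * (volume.withDensity w) (E S) := by
    rintro ⟨S, hSm⟩
    simp only
    rw [indicator_indicator]
    by_cases h1 : ∃ z ∈ S.toSet, z ∈ A
    swap
    · push Not at h1
      rw [cubeAvg_zero S r hr A h1]; simp
    by_cases h2 : ∃ x ∈ S.toSet, x ∈ F S ∩ B
    swap
    · push Not at h2
      rw [cubeAvg_zero S s hs _ h2]; simp
    obtain ⟨z, hzS, hzA⟩ := h1
    obtain ⟨x, hxS, hxF, hxB⟩ := h2
    have hl0 := S.side_pos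
    have hside : 1/2 ≤ n * S.side := (hAB z hzA x hxB).trans (cube_norm_sub S hzS hxS)
    have hnorm : ∀ y ∈ E S, 1 + ‖y‖ ≤ L * S.side := by
      intro y hy
      have h3 := cube_norm_sub S (hES S hSm hy) hxS
      have h4 := norm_add_le (y - x) x
      rw [sub_add_cancel] at h4
      have := hB3 x hxB
      rw [hL]; linarith
    have hwE : ENNReal.ofReal ((L * S.side) ^ (-(n * p))) * volume (E S) ≤
        (volume.withDensity w) (E S) := by
      rw [withDensity_apply _ (hEm S hSm), ← setLIntegral_const]
      refine setLIntegral_mono (by fun_prop) fun y hy => ?_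
      refine ENNReal.ofReal_le_ofReal ?_
      refine Real.rpow_le_rpow_of_nonpos (by positivity) (hnorm y hy) ?_
      have : 0 < n * p := by positivity
      linarith
    have hc1 := cubeAvg_le S r hr A hA A subset_rfl hA a ha hAa
    have hc2 := cubeAvg_le S s hs B hB (F S ∩ B) inter_subset_right ((hFm S hSm).inter hB) b hb hBb
    calc _ ≤ (4 * volume (E S)) * ENNReal.ofReal (((S.side ^ n)⁻¹ * a) ^ (1/r)) *
          ENNReal.ofReal (((S.side ^ n)⁻¹ * b) ^ (1/s)) := by
          gcongr
          exact (hEv S hSm).le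
      _ = ENNReal.ofReal (K0 * a ^ (1/r) * b ^ (1/s)) *
          (ENNReal.ofReal ((L * S.side) ^ (-(n * p))) * volume (E S)) := by
          have e4 : (4:ℝ≥0∞) = ENNReal.ofReal 4 := by norm_num
          rw [← mul_assoc, ← ENNReal.ofReal_mul (by positivity), mul_assoc (4 * volume (E S)),
            ← ENNReal.ofReal_mul (by positivity), mul_comm 4, mul_assoc, e4,
            ← ENNReal.ofReal_mul (by positivity), mul_comm]
          congr 2
          rw [Real.mul_rpow (by positivity) ha, Real.mul_rpow (by positivity) hb,
            Real.mul_rpow hL0.le hl0.le, hK0, Real.rpow_neg hL0.le]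
          have e5 : ((S.side ^ n)⁻¹) ^ (1/r) * ((S.side ^ n)⁻¹) ^ (1/s) = S.side ^ (-(n * p)) := by
            rw [← Real.rpow_add (by positivity), ← Real.rpow_natCast, ← Real.rpow_neg hl0.le,
              ← Real.rpow_mul hl0.le, hp]
            congr 1; ring
          rw [← e5]
          have : L ^ (n * p) ≠ 0 := by positivity
          field_simp
      _ ≤ _ := by gcongr
  rw [sparseFormM]
  calc _ ≤ ∑' S : 𝒮, ENNReal.ofReal (K0 * a ^ (1/r) * b ^ (1/s)) * (volume.withDensity w) (E S) :=
        ENNReal.tsum_le_tsum key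
    _ = ENNReal.ofReal (K0 * a ^ (1/r) * b ^ (1/s)) * ∑' S : 𝒮, (volume.withDensity w) (E S) :=
        ENNReal.tsum_mul_left
    _ ≤ ENNReal.ofReal (K0 * a ^ (1/r) * b ^ (1/s)) * ENNReal.ofReal (I + 1) := by
        gcongr
        refine (tsum_meas_le_meas_iUnion_of_disjoint (volume.withDensity w)
          (As := fun S : 𝒮 => E S) (fun S => hEm S S.2) ?_).trans ?_
        · intro S T hST
          exact hEd S.2 T.2 (fun h => hST (Subtype.ext h))
        · refine (measure_mono (subset_univ _)).trans ?_
          rw [withDensity_apply _ MeasurableSet.univ, Measure.restrict_univ, hIr]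
          exact ENNReal.ofReal_le_ofReal (by linarith)
    _ = _ := by
        rw [← ENNReal.ofReal_mul (by positivity)]
        congr 1; ring

end sparseUpper

section lowerBound

lemma sphereAvg_indicator (n : ℕ) (t : ℝ) (A : Set (Rn n)) (hA : IsOpen A) (x : Rn n) :
    sphereAvg n t (fun z => |A.indicator (fun _ => (1:ℝ)) z|) x =
      (sphMeasure n {y | x - t • y ∈ A}).toReal := by
  have hm : MeasurableSet {y : Rn n | x - t • y ∈ A} :=
    (hA.preimage (by fun_prop : Continuous fun y : Rn n => x - t • y)).measurableSet
  have : (fun y => |A.indicator (fun _ => (1:ℝ)) (x - t • y)|) =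
      {y : Rn n | x - t • y ∈ A}.indicator (fun _ => (1:ℝ)) := by
    ext y
    by_cases h : x - t • y ∈ A <;> simp [h]
  rw [sphereAvg, this, integral_indicator hm]
  simp [measureReal_def]

lemma lsc_sphere (n : ℕ) [IsProbabilityMeasure (sphMeasure n)] (t : ℝ) (A : Set (Rn n)) (hA : IsOpen A) :
    LowerSemicontinuous (fun x => sphereAvg n t (fun z => |A.indicator (fun _ => (1:ℝ)) z|) x) := by
  simp_rw [sphereAvg_indicator n t A hA]
  intro x c hc
  rcases lt_or_ge c 0 with h0 | h0
  · exact Filter.Eventually.of_forall fun y => h0.trans_le ENNReal.toReal_nonneg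
  have hopen : IsOpen {y : Rn n | x - t • y ∈ A} :=
    hA.preimage (by fun_prop : Continuous fun y : Rn n => x - t • y)
  have hc' : ENNReal.ofReal c < sphMeasure n {y | x - t • y ∈ A} := by
    rwa [ENNReal.ofReal_lt_iff_lt_toReal h0 (measure_ne_top _ _)]
  obtain ⟨K, hK, hKc, hcK⟩ := hopen.exists_lt_isCompact hc'
  have := hKc.eventually_forall_of_forall_eventually (x₀ := x) (P := fun x y => x - t • y ∈ A) (by
    intro y hy
    have hcont : Continuous (fun z : Rn n × Rn n => z.1 - t • z.2) := by fun_prop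
    exact (hA.preimage hcont).mem_nhds (hK hy))
  filter_upwards [this] with x' hx'
  refine (ENNReal.ofReal_lt_iff_lt_toReal h0 (measure_ne_top _ _)).1 ?_
  exact hcK.trans_le (measure_mono hx')

lemma lower_bound (n : ℕ) [IsProbabilityMeasure (sphMeasure n)] (A B : Set (Rn n)) (hA : IsOpen A)
    (hB : MeasurableSet B) (hBfin : volume B ≠ ⊤) (h : ℝ) (hh : 0 ≤ h)
    (hAB : ∀ x ∈ B, ∃ t : ℝ, 0 < t ∧ ENNReal.ofReal h ≤ sphMeasure n {y | x - t • y ∈ A}) :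
    ENNReal.ofReal h * volume B ≤ ENNReal.ofReal
      (∫ x, Mfull n (A.indicator fun _ => 1) x * B.indicator (fun _ => 1) x) := by
  have hle1 : ∀ t x, sphereAvg n t (fun z => |A.indicator (fun _ => (1:ℝ)) z|) x ≤ 1 := by
    intro t x
    rw [sphereAvg_indicator n t A hA]
    exact measureReal_le_one
  have hbdd : ∀ x, BddAbove (range fun t : {t : ℝ // 0 < t} =>
      sphereAvg n t (fun z => |A.indicator (fun _ => (1:ℝ)) z|) x) := by
    intro x
    refine ⟨1, ?_⟩
    rintro _ ⟨t, rfl⟩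
    exact hle1 t x
  haveI : Nonempty {t : ℝ // 0 < t} := ⟨⟨1, one_pos⟩⟩
  have hmeas : Measurable (Mfull n (A.indicator fun _ => 1)) :=
    (lowerSemicontinuous_ciSup hbdd (fun t => lsc_sphere n t A hA)).measurable
  have hM1 : ∀ x, Mfull n (A.indicator fun _ => 1) x ≤ 1 := fun x => ciSup_le fun t => hle1 t x
  have hMh : ∀ x ∈ B, h ≤ Mfull n (A.indicator fun _ => 1) x := by
    intro x hx
    obtain ⟨t, ht, hth⟩ := hAB x hx
    refine le_trans ?_ (le_ciSup (hbdd x) ⟨t, ht⟩)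
    simp only
    rw [sphereAvg_indicator n t A hA]
    exact (ENNReal.ofReal_le_iff_le_toReal (measure_ne_top _ _)).1 hth
  have e : (fun x => Mfull n (A.indicator fun _ => 1) x * B.indicator (fun _ => 1) x) =
      B.indicator (Mfull n (A.indicator fun _ => 1)) := by
    ext x; by_cases hx : x ∈ B <;> simp [hx]
  rw [e, integral_indicator hB, ← ENNReal.ofReal_toReal hBfin, ← ENNReal.ofReal_mul hh]
  refine ENNReal.ofReal_le_ofReal ?_
  have hM0 : ∀ x, 0 ≤ Mfull n (A.indicator fun _ => 1) x := fun x => by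
    refine Real.iSup_nonneg fun t => ?_
    rw [sphereAvg_indicator n t A hA]; positivity
  have hint : IntegrableOn (Mfull n (A.indicator fun _ => 1)) B := by
    refine Measure.integrableOn_of_bounded (M := 1) hBfin hmeas.aestronglyMeasurable ?_
    refine Filter.Eventually.of_forall fun x => ?_
    rw [Real.norm_eq_abs, abs_of_nonneg (hM0 x)]; exact hM1 x
  have := setIntegral_ge_of_const_le_real (c := h) hB hBfin hMh hint
  simpa [measureReal_def] using this

lemma core (n : ℕ) (hn : 1 ≤ n) [IsProbabilityMeasure (sphMeasure n)] (r s : ℝ) (hr : 1 ≤ r)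
    (hs : 1 ≤ s) (hrs : 1 < 1/r + 1/s) (α β γ a b b' c ε₀ : ℝ) (ha : 0 < a) (hb : 0 < b)
    (hb' : 0 < b') (hc : 0 < c) (hε₀ : 0 < ε₀) (hcond : β + γ < α * (1/r) + β * (1/s))
    (H : ∀ ε, 0 < ε → ε ≤ ε₀ → ∃ A B : Set (Rn n), IsOpen A ∧ MeasurableSet B ∧
      Bornology.IsBounded A ∧ (∀ x ∈ B, ‖x‖ ≤ 3) ∧ (∀ z ∈ A, ∀ x ∈ B, 1/2 ≤ ‖z - x‖) ∧
      volume A ≤ ENNReal.ofReal (a * ε ^ α) ∧ volume B ≤ ENNReal.ofReal (b * ε ^ β) ∧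
      ENNReal.ofReal (b' * ε ^ β) ≤ volume B ∧
      ∀ x ∈ B, ∃ t : ℝ, 0 < t ∧ ENNReal.ofReal (c * ε ^ γ) ≤ sphMeasure n {y | x - t • y ∈ A}) :
    ∀ C : ℝ, ∃ f g : Rn n → ℝ, Measurable f ∧ Measurable g ∧
      (∀ x, 0 ≤ f x) ∧ (∀ x, 0 ≤ g x) ∧
      (∃ M, ∀ x, f x ≤ M) ∧ (∃ M, ∀ x, g x ≤ M) ∧
      HasCompactSupport f ∧ HasCompactSupport g ∧
      ENNReal.ofReal C * supSparseFormM n r s f g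
        < ENNReal.ofReal (∫ x, Mfull n f x * g x) := by
  intro C
  obtain ⟨K, hK, hup⟩ := sparse_upper n hn r s hr hs hrs
  set θ := α * (1/r) + β * (1/s) - β - γ with hθ
  have hθ0 : 0 < θ := by rw [hθ]; linarith
  set D := max C 0 * (K * a ^ (1/r) * b ^ (1/s)) with hD
  have hlim : Filter.Tendsto (fun ε : ℝ => D * ε ^ θ) (nhdsWithin 0 (Ioi 0)) (nhds 0) := by
    have h1 : Filter.Tendsto (fun ε : ℝ => D * ε ^ θ) (nhds 0) (nhds (D * 0 ^ θ)) :=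
      ((Real.continuousAt_rpow_const 0 θ (Or.inr hθ0.le)).tendsto).const_mul D
    rw [Real.zero_rpow hθ0.ne', mul_zero] at h1
    exact h1.mono_left nhdsWithin_le_nhds
  have hev : ∀ᶠ ε : ℝ in nhdsWithin 0 (Ioi 0), D * ε ^ θ < c * b' ∧ 0 < ε ∧ ε ≤ ε₀ := by
    refine (hlim.eventually_lt_const (by positivity)).and ?_
    have h2 : ∀ᶠ ε : ℝ in nhdsWithin 0 (Ioi 0), 0 < ε := self_mem_nhdsWithin
    exact h2.and (nhdsWithin_le_nhds (Iic_mem_nhds hε₀))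
  obtain ⟨ε, h1, hε, hεε⟩ := hev.exists
  obtain ⟨A, B, hA, hB, hAbd, hB3, hAB, hvA, hvB, hvB', hcap⟩ := H ε hε hεε
  refine ⟨A.indicator fun _ => 1, B.indicator fun _ => 1, measurable_const.indicator hA.measurableSet,
    measurable_const.indicator hB, fun x => indicator_nonneg (by simp) x,
    fun x => indicator_nonneg (by simp) x, ⟨1, fun x => indicator_le_self' (by simp) x⟩,
    ⟨1, fun x => indicator_le_self' (by simp) x⟩, ?_, ?_, ?_⟩
  · exact HasCompactSupport.of_support_subset_isCompact hAbd.isCompact_closure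
      (support_indicator_subset.trans subset_closure)
  · refine HasCompactSupport.of_support_subset_isCompact (isCompact_closedBall 0 3)
      (support_indicator_subset.trans fun x hx => ?_)
    simpa using hB3 x hx
  · have hlow := lower_bound n A B hA hB (hvB.trans_lt ENNReal.ofReal_lt_top).ne (c * ε ^ γ)
      (by positivity) hcap
    refine lt_of_lt_of_le ?_ hlow
    have hu := hup A B (a * ε ^ α) (b * ε ^ β) hA.measurableSet hB (by positivity) (by positivity)
      hvA hvB hB3 hAB
    calc _ ≤ ENNReal.ofReal (max C 0) *
          ENNReal.ofReal (K * (a * ε ^ α) ^ (1/r) * (b * ε ^ β) ^ (1/s)) := by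
          gcongr; exact le_max_left _ _
      _ = ENNReal.ofReal ((D * ε ^ θ) * (ε ^ γ * ε ^ β)) := by
          rw [← ENNReal.ofReal_mul (le_max_right _ _)]
          congr 1
          have e1 : ε ^ θ * (ε ^ γ * ε ^ β) = ε ^ (α * (1/r)) * ε ^ (β * (1/s)) := by
            rw [← Real.rpow_add hε, ← Real.rpow_add hε, ← Real.rpow_add hε]
            congr 1; rw [hθ]; ring
          rw [Real.mul_rpow ha.le (by positivity), Real.mul_rpow hb.le (by positivity),
            ← Real.rpow_mul hε.le, ← Real.rpow_mul hε.le, mul_assoc D, e1, hD]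
          ring
      _ < ENNReal.ofReal ((c * b') * (ε ^ γ * ε ^ β)) := by
          rw [ENNReal.ofReal_lt_ofReal_iff (by positivity)]
          exact mul_lt_mul_of_pos_right h1 (by positivity)
      _ = ENNReal.ofReal (c * ε ^ γ) * ENNReal.ofReal (b' * ε ^ β) := by
          rw [← ENNReal.ofReal_mul (by positivity)]; congr 1; ring
      _ ≤ _ := by gcongr

end lowerBound

lemma region_cases (n : ℕ) (hn : 2 ≤ n) (x y : ℝ) (hx : 0 < x) (hxy : 1 < x + y)
    (hmem : ((x, y) : ℝ × ℝ) ∉ Fregion n) :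
    (n:ℝ) - 1 < n * x ∨ (n:ℝ) < x + n * y ∨ 2 * ((n:ℝ) - 1) < (n + 1) * x + (n - 1) * y := by
  by_contra hcon
  push Not at hcon
  obtain ⟨h1, h2, h3⟩ := hcon
  apply hmem
  have hn' : (2:ℝ) ≤ n := by exact_mod_cast hn
  set N : ℝ := (n : ℝ) with hN
  have hconv : Convex ℝ (Fregion n) := convex_convexHull _ _
  have hP1 : ((0, 1) : ℝ × ℝ) ∈ Fregion n := subset_convexHull _ _ (by simp)
  have hP2 : ((N-1)/N, 1/N) ∈ Fregion n := subset_convexHull _ _ (by simp [hN])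
  have hP3 : ((N-1)/N, (N-1)/N) ∈ Fregion n := subset_convexHull _ _ (by simp [hN])
  have hP4 : ((N^2 - N)/(N^2+1), (N^2 - N + 2)/(N^2 + 1)) ∈ Fregion n :=
    subset_convexHull _ _ (by simp [hN])
  have hN1 : 0 < N - 1 := by linarith
  have hN0 : 0 < N := by linarith
  have comb : ∀ (p q : ℝ × ℝ), p ∈ Fregion n → q ∈ Fregion n → ∀ t : ℝ, 0 ≤ t → t ≤ 1 →
      ((1 - t) * p.1 + t * q.1, (1 - t) * p.2 + t * q.2) ∈ Fregion n := by
    intro p q hp hq t ht0 ht1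
    have := hconv hp hq (sub_nonneg.2 ht1) ht0 (by ring)
    have e : ((1 - t) * p.1 + t * q.1, (1 - t) * p.2 + t * q.2) = (1 - t) • p + t • q := by
      ext <;> simp
    rw [e]; exact this
  have hlow : (x, 1 - x) ∈ Fregion n := by
    have := comb _ _ hP1 hP2 (N * x / (N - 1)) (by positivity) (by rw [div_le_one hN1]; exact h1)
    convert this using 2
    · field_simp; ring
    · field_simp; ring
  have hfib : Convex ℝ {v : ℝ | (x, v) ∈ Fregion n} := by
    intro u hu v hv a b ha hb hab
    have := hconv hu hv ha hb hab
    have e : a • (x, u) + b • (x, v) = (x, a • u + b • v) := by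
      ext
      · simp only [Prod.fst_add, Prod.smul_fst, smul_eq_mul]; rw [← add_mul, hab, one_mul]
      · simp
    rw [e] at this
    exact this
  have hoc := hfib.ordConnected
  have hup : ∃ v, y ≤ v ∧ (x, v) ∈ Fregion n := by
    rcases le_total (x * (N^2+1)) (N^2 - N) with h4 | h4
    · refine ⟨1 - x / N, ?_, ?_⟩
      · rw [le_sub_iff_add_le]
        have : y + x / N = (x + N * y) / N := by field_simp; ring
        rw [this, div_le_one hN0]; exact h2
      · have hpos : 0 < N^2 - N := by nlinarith
        have := comb _ _ hP1 hP4 (x * (N^2+1) / (N^2 - N)) (by positivity)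
          (by rw [div_le_one hpos]; exact h4)
        convert this using 2
        · field_simp; ring
        · have h5 : N^2 - N = N * (N - 1) := by ring
          rw [h5]
          field_simp; ring
    · refine ⟨(2 * (N-1) - (N+1) * x) / (N-1), ?_, ?_⟩
      · rw [le_div_iff₀ hN1]; linarith
      · have := comb _ _ hP4 hP3 ((N * (x * (N^2+1)) - N * (N^2-N)) / (N - 1))
          (div_nonneg (by nlinarith) hN1.le)
          (by rw [div_le_one hN1]; nlinarith)
        convert this using 2
        · field_simp; ring
        · field_simp; ring
  obtain ⟨v, hv, hvF⟩ := hup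
  exact hoc.out (show (1 - x) ∈ {v : ℝ | (x, v) ∈ Fregion n} from hlow) hvF ⟨by linarith, hv⟩

section families

lemma zero_sub_sum_aux (m : ℕ) (ρ : ℝ) (hρ : 0 < ρ) (h : m * ρ ^ 2 ≤ 1) :
    ∀ b : Fin m → ℝ, (∀ i, |b i - (0 : Fin m → ℝ) i| ≤ ρ) → ∑ i, b i ^ 2 ≤ 1 := by
  intro b hb
  have : ∀ i, b i ^ 2 ≤ ρ ^ 2 := by
    intro i
    rw [sq_le_sq, abs_of_pos hρ]; simpa using hb i
  calc _ ≤ ∑ i : Fin m, ρ ^ 2 := Finset.sum_le_sum fun i _ => this i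
    _ = m * ρ ^ 2 := by simp
    _ ≤ 1 := h

/-- Case (b): neighbourhood of the sphere against a small ball. -/
lemma fam_b (m : ℕ) (hm : 1 ≤ m) : ∃ a b b' : ℝ, 0 < a ∧ 0 < b ∧ 0 < b' ∧
    ∀ ε : ℝ, 0 < ε → ε ≤ 1/4 → ∃ A B : Set (Rn (m+1)), IsOpen A ∧ MeasurableSet B ∧
      Bornology.IsBounded A ∧ (∀ x ∈ B, ‖x‖ ≤ 3) ∧ (∀ z ∈ A, ∀ x ∈ B, 1/2 ≤ ‖z - x‖) ∧
      volume A ≤ ENNReal.ofReal (a * ε ^ (1:ℝ)) ∧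
      volume B ≤ ENNReal.ofReal (b * ε ^ ((m:ℝ)+1)) ∧
      ENNReal.ofReal (b' * ε ^ ((m:ℝ)+1)) ≤ volume B ∧
      ∀ x ∈ B, ∃ t : ℝ, 0 < t ∧
        ENNReal.ofReal (1 * ε ^ (0:ℝ)) ≤ sphMeasure (m+1) {y | x - t • y ∈ A} := by
  have := sphMeasure_prob m hm
  set V : ℝ := (volume (ball (0 : Rn (m+1)) 1)).toReal with hV
  have hVf : volume (ball (0 : Rn (m+1)) 1) ≠ ⊤ := measure_ball_lt_top.ne
  have hVe : volume (ball (0 : Rn (m+1)) 1) = ENNReal.ofReal V := (ENNReal.ofReal_toReal hVf).symm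
  have hV0 : 0 < V := ENNReal.toReal_pos (measure_ball_pos _ _ one_pos).ne' hVf
  have hball : ∀ ρ : ℝ, 0 ≤ ρ → volume (ball (0 : Rn (m+1)) ρ) = ENNReal.ofReal (ρ ^ (m+1) * V) := by
    intro ρ hρ
    rw [Measure.addHaar_ball _ _ hρ, hVe, ← ENNReal.ofReal_mul (by positivity)]
    simp
  have hcball : ∀ ρ : ℝ, 0 ≤ ρ → volume (closedBall (0 : Rn (m+1)) ρ) = ENNReal.ofReal (ρ ^ (m+1) * V) := by
    intro ρ hρ
    rw [Measure.addHaar_closedBall _ _ hρ, hVe, ← ENNReal.ofReal_mul (by positivity)]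
    simp
  refine ⟨2 * (m+1) * 2 ^ m * V, V, V, by positivity, hV0, hV0, ?_⟩
  intro ε hε hε4
  refine ⟨ball 0 (1+ε) \ closedBall 0 (1-ε), ball 0 ε, isOpen_ball.sdiff isClosed_closedBall,
    measurableSet_ball, isBounded_ball.subset diff_subset, ?_, ?_, ?_, ?_, ?_, ?_⟩
  · intro x hx
    have : ‖x‖ < ε := by simpa using hx
    linarith
  · rintro z ⟨-, hz⟩ x hx
    have h1 : ‖x‖ < ε := by simpa using hx
    have h2 : 1 - ε < ‖z‖ := by simpa using hz
    have := norm_sub_norm_le z x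
    linarith
  · rw [measure_diff (closedBall_subset_ball (by linarith)) measurableSet_closedBall.nullMeasurableSet
      measure_closedBall_lt_top.ne, hball _ (by linarith), hcball _ (by linarith),
      ← ENNReal.ofReal_sub _ (mul_nonneg (pow_nonneg (by linarith) _) hV0.le)]
    refine ENNReal.ofReal_le_ofReal ?_
    have h3 : (1+ε)^(m+1) - (1-ε)^(m+1) ≤ 2 * (m+1) * 2^m * ε := by
      rw [← Commute.mul_geom_sum₂ (Commute.all _ _)]
      have : ∑ i ∈ Finset.range (m+1), (1+ε)^i * (1-ε)^(m+1-1-i) ≤ ∑ i ∈ Finset.range (m+1), (2:ℝ)^m := by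
        refine Finset.sum_le_sum fun i hi => ?_
        have hi' : i ≤ m := Nat.lt_succ_iff.1 (Finset.mem_range.1 hi)
        calc (1+ε)^i * (1-ε)^(m+1-1-i) ≤ 2^m * 1 := by
              refine mul_le_mul ?_ (pow_le_one₀ (by linarith) (by linarith))
                (pow_nonneg (by linarith) _) (by positivity)
              calc (1+ε)^i ≤ 2^i := pow_le_pow_left₀ (by linarith) (by linarith) _
                _ ≤ 2^m := pow_le_pow_right₀ (by norm_num) hi'
          _ = _ := by ring
      simp only [Finset.sum_const, Finset.card_range, nsmul_eq_mul] at this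
      push_cast at this
      rw [show m + 1 - 1 = m by omega, show 1 + ε - (1 - ε) = 2 * ε by ring]
      have h6 := mul_le_mul_of_nonneg_left this (by linarith : 0 ≤ 2 * ε)
      linarith
    rw [Real.rpow_one]
    nlinarith
  · rw [hball _ hε.le]
    refine ENNReal.ofReal_le_ofReal (le_of_eq ?_)
    rw [show ((m:ℝ)+1) = ((m+1 : ℕ) : ℝ) by push_cast; ring, Real.rpow_natCast]; ring
  · rw [hball _ hε.le]
    refine ENNReal.ofReal_le_ofReal (le_of_eq ?_)
    rw [show ((m:ℝ)+1) = ((m+1 : ℕ) : ℝ) by push_cast; ring, Real.rpow_natCast]; ring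
  · intro x hx
    have h1 : ‖x‖ < ε := by simpa using hx
    refine ⟨1, one_pos, ?_⟩
    have hs : sphMeasure (m+1) (sphere 0 1) = 1 :=
      (prob_compl_eq_zero_iff isClosed_sphere.measurableSet).1 (sphMeasure_compl m)
    simp only [Real.rpow_zero, mul_one, ENNReal.ofReal_one]
    rw [← hs]
    refine measure_mono fun y hy => ?_
    have hy1 : ‖y‖ = 1 := by simpa using hy
    simp only [one_smul, mem_setOf_eq, mem_diff, mem_ball, mem_closedBall, dist_zero_right, not_le]
    have h2 := norm_sub_le x y
    have h3 := norm_sub_norm_le y x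
    rw [norm_sub_rev] at h3
    constructor <;> linarith

/-- Volume of a box. -/
lemma box_volume {n : ℕ} (a b : Fin n → ℝ) :
    volume {x : Rn n | ∀ i, a i < x i ∧ x i < b i} = ∏ i, ENNReal.ofReal (b i - a i) := by
  have h : {x : Rn n | ∀ i, a i < x i ∧ x i < b i} = (MeasurableEquiv.toLp 2 (Fin n → ℝ)).symm ⁻¹'
      (univ.pi fun i => Ioo (a i) (b i)) := by
    ext x
    simp
  rw [h, (EuclideanSpace.volume_preserving_symm_measurableEquiv_toLp (Fin n)).measure_preimage
    (MeasurableSet.univ_pi fun i => measurableSet_Ioo).nullMeasurableSet, Real.volume_pi_Ioo]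

lemma box_open {n : ℕ} (a b : Fin n → ℝ) : IsOpen {x : Rn n | ∀ i, a i < x i ∧ x i < b i} := by
  have : {x : Rn n | ∀ i, a i < x i ∧ x i < b i} = ⋂ i, ({x | a i < x i} ∩ {x | x i < b i}) := by
    ext x; simp
  rw [this]
  exact isOpen_iInter_of_finite fun i => (isOpen_lt (by fun_prop) (by fun_prop)).inter
    (isOpen_lt (by fun_prop) (by fun_prop))

lemma box_succ {m : ℕ} (p q : ℝ) (u v : ℝ) (x : Rn (m+1)) :
    x ∈ {x : Rn (m+1) | ∀ i, (Fin.cons p (fun _ => u) : Fin (m+1) → ℝ) i < x i ∧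
      x i < (Fin.cons q (fun _ => v) : Fin (m+1) → ℝ) i} ↔
    (p < x 0 ∧ x 0 < q) ∧ ∀ i : Fin m, u < x i.succ ∧ x i.succ < v := by
  simp [Fin.forall_fin_succ]

/-- Case (c): Knapp type example. -/
lemma fam_c (m : ℕ) (hm : 1 ≤ m) : ∃ a b b' c ε₀ : ℝ, 0 < a ∧ 0 < b ∧ 0 < b' ∧ 0 < c ∧ 0 < ε₀ ∧
    ∀ ε : ℝ, 0 < ε → ε ≤ ε₀ → ∃ A B : Set (Rn (m+1)), IsOpen A ∧ MeasurableSet B ∧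
      Bornology.IsBounded A ∧ (∀ x ∈ B, ‖x‖ ≤ 3) ∧ (∀ z ∈ A, ∀ x ∈ B, 1/2 ≤ ‖z - x‖) ∧
      volume A ≤ ENNReal.ofReal (a * ε ^ ((m:ℝ)+2)) ∧
      volume B ≤ ENNReal.ofReal (b * ε ^ (m:ℝ)) ∧
      ENNReal.ofReal (b' * ε ^ (m:ℝ)) ≤ volume B ∧
      ∀ x ∈ B, ∃ t : ℝ, 0 < t ∧
        ENNReal.ofReal (c * ε ^ (m:ℝ)) ≤ sphMeasure (m+1) {y | x - t • y ∈ A} := by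
  obtain ⟨c, hc, hcap⟩ := sphMeasure_cap m hm
  have hm' : (1:ℝ) ≤ m := by exact_mod_cast hm
  refine ⟨8 ^ m * (8 * m), 2 ^ m, 2 ^ m, c, 1/(8*m), by positivity, by positivity, by positivity, hc,
    by positivity, ?_⟩
  intro ε hε hε0
  have hmε : m * ε ≤ 1/8 := by
    rw [le_div_iff₀ (by positivity)] at hε0; linarith
  have hε8 : ε ≤ 1/8 := by nlinarith
  have hmε2 : m * ε ^ 2 ≤ 1/64 := by nlinarith
  have hA0 : 0 < m * ε ^ 2 := by positivity
  refine ⟨{x : Rn (m+1) | ∀ i, (Fin.cons (-(4 * (m * ε^2))) (fun _ => -(4*ε)) : Fin (m+1) → ℝ) i < x i ∧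
      x i < (Fin.cons (4 * (m * ε^2)) (fun _ => 4*ε) : Fin (m+1) → ℝ) i},
    {x : Rn (m+1) | ∀ i, (Fin.cons 1 (fun _ => -ε) : Fin (m+1) → ℝ) i < x i ∧
      x i < (Fin.cons 2 (fun _ => ε) : Fin (m+1) → ℝ) i}, box_open _ _, (box_open _ _).measurableSet,
    ?_, ?_, ?_, ?_, ?_, ?_, ?_⟩
  · refine (isBounded_ball (x := (0 : Rn (m+1))) (r := 3)).subset fun z hz => ?_
    rw [box_succ] at hz
    rw [mem_ball_zero_iff]
    refine (norm_le_sum_abs z).trans_lt ?_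
    rw [Fin.sum_univ_succ]
    have h1 : |z 0| ≤ 4 * (m * ε^2) := abs_le.2 ⟨hz.1.1.le, hz.1.2.le⟩
    have h2 : ∑ i : Fin m, |z i.succ| ≤ m * (4 * ε) := by
      calc _ ≤ ∑ i : Fin m, 4 * ε :=
            Finset.sum_le_sum fun i _ => abs_le.2 ⟨(hz.2 i).1.le, (hz.2 i).2.le⟩
        _ = _ := by simp
    linarith
  · intro z hz
    rw [box_succ] at hz
    refine (norm_le_sum_abs z).trans ?_
    rw [Fin.sum_univ_succ]
    have h1 : |z 0| ≤ 2 := abs_le.2 ⟨by linarith [hz.1.1], hz.1.2.le⟩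
    have h2 : ∑ i : Fin m, |z i.succ| ≤ m * ε := by
      calc _ ≤ ∑ i : Fin m, ε :=
            Finset.sum_le_sum fun i _ => abs_le.2 ⟨(hz.2 i).1.le, (hz.2 i).2.le⟩
        _ = _ := by simp
    linarith
  · intro z hz x hx
    rw [box_succ] at hz hx
    refine le_trans ?_ (abs_apply_le (z - x) 0)
    rw [PiLp.sub_apply, abs_sub_comm]
    refine le_trans ?_ (le_abs_self _)
    linarith [hz.1.2, hx.1.1]
  · rw [box_volume, Fin.prod_univ_succ]
    simp only [Fin.cons_zero, Fin.cons_succ, Finset.prod_const, Finset.card_univ, Fintype.card_fin]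
    rw [← ENNReal.ofReal_pow (by linarith), ← ENNReal.ofReal_mul (by linarith)]
    refine ENNReal.ofReal_le_ofReal (le_of_eq ?_)
    rw [show ((m:ℝ)+2) = ((m+2 : ℕ) : ℝ) by push_cast; ring, Real.rpow_natCast,
      show 4 * ε - -(4*ε) = 8 * ε by ring, mul_pow]; ring
  · rw [box_volume, Fin.prod_univ_succ]
    simp only [Fin.cons_zero, Fin.cons_succ, Finset.prod_const, Finset.card_univ, Fintype.card_fin]
    rw [← ENNReal.ofReal_pow (by linarith), ← ENNReal.ofReal_mul (by linarith)]
    refine ENNReal.ofReal_le_ofReal (le_of_eq ?_)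
    rw [Real.rpow_natCast, show ε - -ε = 2 * ε by ring, mul_pow]; ring
  · rw [box_volume, Fin.prod_univ_succ]
    simp only [Fin.cons_zero, Fin.cons_succ, Finset.prod_const, Finset.card_univ, Fintype.card_fin]
    rw [← ENNReal.ofReal_pow (by linarith), ← ENNReal.ofReal_mul (by linarith)]
    refine ENNReal.ofReal_le_ofReal (le_of_eq ?_)
    rw [Real.rpow_natCast, show ε - -ε = 2 * ε by ring, mul_pow]; ring
  · intro x hx
    rw [box_succ] at hx
    obtain ⟨⟨hx1, hx2⟩, hxi⟩ := hx
    refine ⟨x 0, by linarith, ?_⟩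
    rw [Real.rpow_natCast]
    refine hcap 0 ε hε (zero_sub_sum_aux m ε hε (by linarith)) _ ?_
    rintro y ⟨⟨hy0, hyi⟩, hys⟩
    have hy1 : ‖y‖ = 1 := by simpa using hys
    have hsq := norm_sq_succ y
    rw [hy1] at hsq
    have hyi' : ∀ i : Fin m, |y i.succ| ≤ ε := fun i => by simpa using hyi i
    have hsum : ∑ i : Fin m, y i.succ ^ 2 ≤ m * ε ^ 2 := by
      calc _ ≤ ∑ i : Fin m, ε ^ 2 := Finset.sum_le_sum fun i _ => by
            rw [sq_le_sq, abs_of_pos hε]; exact hyi' i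
        _ = _ := by simp
    have hsum0 : 0 ≤ ∑ i : Fin m, y i.succ ^ 2 := Finset.sum_nonneg fun i _ => sq_nonneg _
    have hy01 : y 0 ≤ 1 := by nlinarith
    have hy02 : 1 - y 0 ≤ m * ε ^ 2 := by nlinarith
    rw [mem_setOf_eq, box_succ]
    simp only [PiLp.sub_apply, PiLp.smul_apply, smul_eq_mul]
    refine ⟨⟨?_, ?_⟩, fun i => ?_⟩
    · nlinarith
    · nlinarith
    · have h1 := hxi i
      have h2 : |x 0 * y i.succ| ≤ 2 * ε := by
        rw [abs_mul, abs_of_pos (by linarith)]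
        exact mul_le_mul hx2.le (hyi' i) (abs_nonneg _) (by norm_num)
      rw [abs_le] at h2
      constructor <;> linarith [h1.1, h1.2, h2.1, h2.2]

/-- Case (a): a small ball against a fixed ball. -/
lemma fam_a (m : ℕ) (hm : 1 ≤ m) : ∃ a b b' c ε₀ : ℝ, 0 < a ∧ 0 < b ∧ 0 < b' ∧ 0 < c ∧ 0 < ε₀ ∧
    ∀ ε : ℝ, 0 < ε → ε ≤ ε₀ → ∃ A B : Set (Rn (m+1)), IsOpen A ∧ MeasurableSet B ∧
      Bornology.IsBounded A ∧ (∀ x ∈ B, ‖x‖ ≤ 3) ∧ (∀ z ∈ A, ∀ x ∈ B, 1/2 ≤ ‖z - x‖) ∧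
      volume A ≤ ENNReal.ofReal (a * ε ^ ((m:ℝ)+1)) ∧
      volume B ≤ ENNReal.ofReal (b * ε ^ (0:ℝ)) ∧
      ENNReal.ofReal (b' * ε ^ (0:ℝ)) ≤ volume B ∧
      ∀ x ∈ B, ∃ t : ℝ, 0 < t ∧
        ENNReal.ofReal (c * ε ^ (m:ℝ)) ≤ sphMeasure (m+1) {y | x - t • y ∈ A} := by
  obtain ⟨c, hc, hcap⟩ := sphMeasure_cap m hm
  have hm' : (1:ℝ) ≤ m := by exact_mod_cast hm
  set V : ℝ := (volume (ball (0 : Rn (m+1)) 1)).toReal with hV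
  have hVf : volume (ball (0 : Rn (m+1)) 1) ≠ ⊤ := measure_ball_lt_top.ne
  have hVe : volume (ball (0 : Rn (m+1)) 1) = ENNReal.ofReal V := (ENNReal.ofReal_toReal hVf).symm
  have hV0 : 0 < V := ENNReal.toReal_pos (measure_ball_pos _ _ one_pos).ne' hVf
  have hball : ∀ (z : Rn (m+1)) (ρ : ℝ), 0 ≤ ρ → volume (ball z ρ) = ENNReal.ofReal (ρ ^ (m+1) * V) := by
    intro z ρ hρ
    rw [Measure.addHaar_ball _ _ hρ, hVe, ← ENNReal.ofReal_mul (by positivity)]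
    simp
  set e : Rn (m+1) := EuclideanSpace.single 0 2 with he
  have he0 : e 0 = 2 := by simp [he]
  have hen : ‖e‖ = 2 := by simp [he]
  refine ⟨(13 * m) ^ (m+1) * V, (1/2)^(m+1) * V, (1/2)^(m+1) * V, c, 1/(13*m), by positivity,
    by positivity, by positivity, hc, by positivity, ?_⟩
  intro ε hε hε0
  have hmε : 13 * (m * ε) ≤ 1 := by
    rw [le_div_iff₀ (by positivity)] at hε0; linarith
  refine ⟨ball 0 (13 * m * ε), ball e (1/2), isOpen_ball, measurableSet_ball, isBounded_ball,
    ?_, ?_, ?_, ?_, ?_, ?_⟩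
  · intro x hx
    rw [mem_ball, dist_eq_norm] at hx
    have := norm_add_le (x - e) e
    rw [sub_add_cancel] at this
    linarith
  · intro z hz x hx
    rw [mem_ball, dist_eq_norm, norm_sub_rev] at hx
    rw [mem_ball_zero_iff] at hz
    have h1 := norm_sub_norm_le e x
    have h2 := norm_sub_norm_le x z
    rw [norm_sub_rev] at h2
    linarith
  · rw [hball _ _ (by positivity)]
    refine ENNReal.ofReal_le_ofReal (le_of_eq ?_)
    rw [show ((m:ℝ)+1) = ((m+1 : ℕ) : ℝ) by push_cast; ring, Real.rpow_natCast, mul_pow]; ring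
  · rw [hball _ _ (by positivity)]; simp
  · rw [hball _ _ (by positivity)]; simp
  · intro x hx
    rw [mem_ball, dist_eq_norm] at hx
    have hx0 : 3/2 < x 0 := by
      have := (abs_apply_le (x - e) 0).trans_lt hx
      rw [PiLp.sub_apply, he0, abs_lt] at this
      linarith [this.1]
    have hxn : ‖x‖ < 5/2 := by
      have := norm_add_le (x - e) e
      rw [sub_add_cancel] at this
      linarith
    have hxp : 0 < ‖x‖ := by
      have := abs_apply_le x 0
      linarith [le_abs_self (x 0)]
    refine ⟨‖x‖, hxp, ?_⟩
    set u : Rn (m+1) := ‖x‖⁻¹ • x with hu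
    have hxu : x = ‖x‖ • u := by rw [hu, smul_smul, mul_inv_cancel₀ hxp.ne', one_smul]
    have hun : ‖u‖ = 1 := by rw [hu, norm_smul, norm_inv, norm_norm, inv_mul_cancel₀ hxp.ne']
    have hu0 : 1/2 ≤ u 0 := by
      rw [hu, PiLp.smul_apply, smul_eq_mul, ← div_eq_inv_mul, le_div_iff₀ hxp]; linarith
    have husq := norm_sq_succ u
    rw [hun] at husq
    have hui : ∀ i : Fin m, |u i.succ| ≤ 1 := fun i => hun ▸ abs_apply_le u i.succ
    rw [Real.rpow_natCast]
    have hε1 : ε ≤ 1/13 := by nlinarith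
    refine hcap (fun i => u i.succ) ε hε ?_ _ ?_
    · intro b hb
      have h1 : ∀ i, b i ^ 2 ≤ u i.succ ^ 2 + 3 * ε := by
        intro i
        have h2 := hb i
        have h3 := hui i
        have h5 : b i ^ 2 - u i.succ ^ 2 = (b i - u i.succ) * (b i - u i.succ + 2 * u i.succ) := by ring
        have h6 : |b i ^ 2 - u i.succ ^ 2| ≤ ε * 3 := by
          rw [h5, abs_mul]
          refine mul_le_mul h2 ?_ (abs_nonneg _) hε.le
          refine (abs_add_le _ _).trans ?_
          rw [abs_mul, abs_two]; linarith
        linarith [(abs_le.1 h6).2]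
      have h7 : ∑ i, b i ^ 2 ≤ ∑ i : Fin m, u i.succ ^ 2 + 3 * (m * ε) := by
        calc _ ≤ ∑ i : Fin m, (u i.succ ^ 2 + 3 * ε) := Finset.sum_le_sum fun i _ => h1 i
          _ = _ := by rw [Finset.sum_add_distrib]; simp; ring
      nlinarith
    · rintro y ⟨⟨hy0, hyi⟩, hys⟩
      have hy1 : ‖y‖ = 1 := by simpa using hys
      have hysq := norm_sq_succ y
      rw [hy1] at hysq
      have hyi1 : ∀ i : Fin m, |y i.succ| ≤ 1 := fun i => hy1 ▸ abs_apply_le y i.succ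
      have hd : |∑ i : Fin m, (u i.succ ^ 2 - y i.succ ^ 2)| ≤ 2 * (m * ε) := by
        refine (Finset.abs_sum_le_sum_abs _ _).trans ?_
        calc _ ≤ ∑ i : Fin m, ε * 2 := Finset.sum_le_sum fun i _ => by
              rw [sq_sub_sq, mul_comm, abs_mul]
              refine mul_le_mul ?_ ?_ (abs_nonneg _) hε.le
              · rw [abs_sub_comm]; exact hyi i
              · exact (abs_add_le _ _).trans (by linarith [hui i, hyi1 i])
          _ = _ := by simp; ring
      have hd2 : |y 0 - u 0| ≤ 4 * (m * ε) := by
        have e1 : (y 0 - u 0) * (y 0 + u 0) = ∑ i : Fin m, (u i.succ ^ 2 - y i.succ ^ 2) := by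
          rw [Finset.sum_sub_distrib]; linarith
        rw [← e1, abs_mul, abs_of_pos (by linarith : 0 < y 0 + u 0)] at hd
        nlinarith [abs_nonneg (y 0 - u 0)]
      have hd3 : ‖y - u‖ ≤ 5 * (m * ε) := by
        refine (norm_le_sum_abs _).trans ?_
        rw [Fin.sum_univ_succ]
        have : ∑ i : Fin m, |(y - u) i.succ| ≤ m * ε := by
          calc _ ≤ ∑ i : Fin m, ε := Finset.sum_le_sum fun i _ => hyi i
            _ = _ := by simp
        have h8 : |(y - u) 0| ≤ 4 * (m * ε) := hd2
        linarith
      have h9 : x - ‖x‖ • y = ‖x‖ • (u - y) := by rw [smul_sub, ← hxu]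
      rw [mem_setOf_eq, mem_ball_zero_iff, h9, norm_smul, norm_norm, norm_sub_rev]
      have hp : 0 < m * ε := by positivity
      calc ‖x‖ * ‖y - u‖ ≤ 5/2 * (5 * (m * ε)) := by gcongr
        _ < _ := by linarith

end families

/-- If `1/r + 1/s > 1` and `(1/r, 1/s)` is not in the closed trapezium `F_n`,
then the sparse bound `‖M_full : (r,s)_m‖ < ∞` fails. -/
theorem full_sparse_bound_fails (n : ℕ) (hn : 2 ≤ n) (r s : ℝ) (hr : 1 ≤ r) (hs : 1 ≤ s)
    (hrs : 1 < 1/r + 1/s) (hmem : ((1/r, 1/s) : ℝ × ℝ) ∉ Fregion n) :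
    ∀ C : ℝ, ∃ f g : Rn n → ℝ, Measurable f ∧ Measurable g ∧
      (∀ x, 0 ≤ f x) ∧ (∀ x, 0 ≤ g x) ∧
      (∃ M, ∀ x, f x ≤ M) ∧ (∃ M, ∀ x, g x ≤ M) ∧
      HasCompactSupport f ∧ HasCompactSupport g ∧
      ENNReal.ofReal C * supSparseFormM n r s f g
        < ENNReal.ofReal (∫ x, Mfull n f x * g x) := by
  obtain ⟨m, rfl⟩ : ∃ m, n = m + 1 := ⟨n - 1, by omega⟩
  have hm : 1 ≤ m := by omega
  have := sphMeasure_prob m hm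
  have hx : 0 < 1/r := by positivity
  rcases region_cases (m+1) hn (1/r) (1/s) hx hrs hmem with h | h | h
  · obtain ⟨a, b, b', c, ε₀, ha, hb, hb', hc, hε₀, H⟩ := fam_a m hm
    refine core (m+1) (by omega) r s hr hs hrs _ _ _ a b b' c ε₀ ha hb hb' hc hε₀ ?_ H
    push_cast at h
    linarith
  · obtain ⟨a, b, b', ha, hb, hb', H⟩ := fam_b m hm
    refine core (m+1) (by omega) r s hr hs hrs _ _ _ a b b' 1 (1/4) ha hb hb' one_pos (by norm_num) ?_ H
    push_cast at h
    linarith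
  · obtain ⟨a, b, b', c, ε₀, ha, hb, hb', hc, hε₀, H⟩ := fam_c m hm
    refine core (m+1) (by omega) r s hr hs hrs _ _ _ a b b' c ε₀ ha hb hb' hc hε₀ ?_ H
    push_cast at h
    linarith
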